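/- Let P be a string of length m whose run-length encoding rle(P) = ⟨(c_0,l_0),…,(c_{ρ-1},l_{ρ-1})⟩ has ρ ≥ 2 (i.e., P contains at least two distinct symbols), and let S be a string with run-length encoding of length at least i+1 for some i with 1 ≤ i ≤ |rle(S)| − 1. Then there exists at most one index j' in the interval [α_S(i), β_S(i)] such that the prefix S[0..j'] of S is a suffix of P; moreover, if such a j' exists then j' = α_S(i) + l_{ρ-1} − 1. -/

import Mathlib

/-- Decoding of a run-length encoding: concatenation of the runs. -/
def decodeRLE {α : Type*} (r : List (α × ℕ)) : List α :=
  r.foldr (fun p acc => List.replicate p.2 p.1 ++ acc) []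

/-- `IsRLE r S` : `r` is the run-length encoding of `S`
    (all run lengths are ≥ 1, adjacent runs have distinct symbols, decoding gives `S`). -/
def IsRLE {α : Type*} (r : List (α × ℕ)) (S : List α) : Prop :=
  (∀ p ∈ r, 1 ≤ p.2) ∧ List.Chain' (fun p q => p.1 ≠ q.1) r ∧ decodeRLE r = S

/-- `rleStart r k` = α(k), the starting position of run `k` (sum of lengths of runs before `k`). -/
def rleStart {α : Type*} (r : List (α × ℕ)) (k : ℕ) : ℕ :=
  ((r.take k).map Prod.snd).sum

theorem decodeRLE_append {α : Type*} (r s : List (α × ℕ)) :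
    decodeRLE (r ++ s) = decodeRLE r ++ decodeRLE s := by
  induction r with
  | nil => simp [decodeRLE]
  | cons p r ih =>
    simp only [decodeRLE, List.cons_append, List.foldr_cons, List.append_assoc] at ih ⊢
    rw [ih]

theorem decodeRLE_singleton {α : Type*} (p : α × ℕ) :
    decodeRLE [p] = List.replicate p.2 p.1 := by
  simp [decodeRLE]

theorem length_decodeRLE {α : Type*} (r : List (α × ℕ)) :
    (decodeRLE r).length = (r.map Prod.snd).sum := by
  induction r with
  | nil => simp [decodeRLE]
  | cons p r ih => simp_all [decodeRLE]

/-- Splitting a string at the start of a run that is not the first one. -/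
theorem IsRLE.exists_eq_append {α : Type*} {r : List (α × ℕ)} {S : List α} (h : IsRLE r S)
    {i : ℕ} (hi : 1 ≤ i) (hir : i < r.length) :
    ∃ A y, y ≠ r[i].1 ∧ (A ++ [y]).length = rleStart r i ∧
      S = A ++ [y] ++ List.replicate r[i].2 r[i].1 ++ decodeRLE (r.drop (i + 1)) := by
  obtain ⟨hpos, hchain, rfl⟩ := h
  obtain ⟨k, rfl⟩ : ∃ k, i = k + 1 := ⟨i - 1, by omega⟩
  have hne : r[k].1 ≠ r[k + 1].1 := List.isChain_iff_getElem.1 hchain k hir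
  obtain ⟨n, hn⟩ : ∃ n, r[k].2 = n + 1 :=
    ⟨r[k].2 - 1, by have := hpos r[k] (List.getElem_mem _); omega⟩
  have htake : decodeRLE (r.take (k + 1)) =
      decodeRLE (r.take k) ++ List.replicate n r[k].1 ++ [r[k].1] := by
    rw [List.take_succ_eq_append_getElem (by omega), decodeRLE_append, decodeRLE_singleton, hn,
      List.replicate_succ', List.append_assoc]
  refine ⟨decodeRLE (r.take k) ++ List.replicate n r[k].1, r[k].1, hne, ?_, ?_⟩
  · rw [← htake, length_decodeRLE, rleStart]
  · rw [← htake, ← decodeRLE_singleton, ← decodeRLE_append, ← decodeRLE_append,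
      ← List.take_succ_eq_append_getElem hir, List.take_append_drop]

/-- The length of a maximal leading run is determined by the string. -/
theorem replicate_append_cons_inj {α : Type*} {x y c z : α} (hy : y ≠ x) (hz : z ≠ c)
    {a l : ℕ} (ha : 1 ≤ a) (hl : 1 ≤ l) {u v : List α}
    (h : List.replicate a x ++ y :: u = List.replicate l c ++ z :: v) : a = l := by
  obtain ⟨a, rfl⟩ : ∃ n, a = n + 1 := ⟨a - 1, by omega⟩
  obtain ⟨l, rfl⟩ : ∃ n, l = n + 1 := ⟨l - 1, by omega⟩
  simp only [List.replicate_succ, List.cons_append, List.cons.injEq] at h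
  obtain ⟨rfl, h⟩ := h
  clear ha hl
  induction a generalizing l with
  | zero => cases l <;> simp_all [List.replicate_succ]
  | succ a ih =>
    cases l with
    | zero => simp_all [List.replicate_succ]
    | succ l =>
      have := ih l (by simpa [List.replicate_succ] using h)
      omega

theorem stmt_3 {α : Type*} [Fintype α] (P S : List α) (rP rS : List (α × ℕ))
    (hP : IsRLE rP P) (hS : IsRLE rS S)
    (hρ : 2 ≤ rP.length)
    (i : ℕ) (hi1 : 1 ≤ i) (hi2 : i + 1 ≤ rS.length)
    (j' : ℕ)
    (h1 : rleStart rS i ≤ j')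
    (h2 : j' ≤ rleStart rS i + (rS[i]'(by omega)).2 - 1)
    (h3 : S.take (j' + 1) <:+ P) :
    j' = rleStart rS i + (rP[rP.length - 1]'(by omega)).2 - 1 := by
  obtain ⟨A, y, hy, hA, hS'⟩ := hS.exists_eq_append hi1 (by omega)
  obtain ⟨B, z, hz, -, hP'⟩ := hP.exists_eq_append (i := rP.length - 1) (by omega) (by omega)
  have hlS := hS.1 rS[i] (List.getElem_mem _)
  have hlP := hP.1 (rP[rP.length - 1]) (List.getElem_mem _)
  obtain ⟨a, ha⟩ : ∃ a, j' + 1 = rleStart rS i + a := ⟨j' + 1 - rleStart rS i, by omega⟩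
  have htake : S.take (j' + 1) = A ++ [y] ++ List.replicate a rS[i].1 := by
    rw [hS', ha, ← hA, List.append_assoc (A ++ [y]), List.take_length_add_append,
      List.take_append_of_le_length (by simp; omega), List.take_replicate,
      Nat.min_eq_left (by omega)]
  rw [List.drop_eq_nil_of_le (by omega)] at hP'
  obtain ⟨T, hT⟩ := h3
  rw [htake, hP'] at hT
  have hrev := congrArg List.reverse hT
  simp only [decodeRLE, List.foldr_nil, List.append_nil, List.reverse_append,
    List.reverse_replicate, List.reverse_cons, List.append_assoc, List.singleton_append]
    at hrev
  have := replicate_append_cons_inj hy hz (by omega) hlP hrev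
  omega
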